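/- Let A be an abelian group and 𝒞 a set of abelian groups, and put B = ⊕𝒞 (the direct sum of all members of 𝒞). Then the following are equivalent: (1) A is B-small; (2) A is 𝒞-small; (3) A is 𝒟-small, where 𝒟 = Add(B) is the class of all abelian groups that are direct summands of B^{(κ)} for some cardinal κ. -/

import Mathlib

/-- `A` is small relative to the family `(N i)_{i ∈ I}`: every homomorphism from `A`
to the direct sum `⊕_{i∈I} N i` has image contained in a finite subsum. -/
def IsFamilySmall (A : Type*) [AddCommGroup A] {I : Type} (N : I → Type*)
    [∀ i, AddCommGroup (N i)] : Prop :=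
  ∀ f : A →+ Π₀ i, N i, ∃ F : Finset I, ∀ (a : A) (i : I), i ∉ F → f a i = 0

/-- `A` is `B`-small: for every index set `I`, every homomorphism `A → B^{(I)}`
has image contained in `B^{(F)}` for some finite `F ⊆ I`. -/
def IsBSmall (A : Type*) (B : Type*) [AddCommGroup A] [AddCommGroup B] : Prop :=
  ∀ (I : Type), IsFamilySmall A (fun _ : I => B)

/-- `A` is `𝒞`-small for the set of groups `𝒞 = {C j | j ∈ ι}`: `A` is small relative to
every family of groups whose members belong to `𝒞`. -/
def IsClassSmall (A : Type*) [AddCommGroup A] {ι : Type} (C : ι → Type*)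
    [∀ j, AddCommGroup (C j)] : Prop :=
  ∀ (I : Type) (g : I → ι), IsFamilySmall A (fun i => C (g i))

/-- `D` belongs to `Add(B)`: `D` is a direct summand of a direct sum `B^{(K)}` of
copies of `B`. -/
def MemAdd (B : Type*) (D : Type*) [AddCommGroup B] [AddCommGroup D] : Prop :=
  ∃ (K : Type) (s : D →+ Π₀ _ : K, B) (r : (Π₀ _ : K, B) →+ D),
    r.comp s = AddMonoidHom.id D

/-- Smallness is inherited by families that embed termwise. -/
theorem IsFamilySmall.of_injective {A : Type*} [AddCommGroup A] {I : Type} {N M : I → Type*}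
    [∀ i, AddCommGroup (N i)] [∀ i, AddCommGroup (M i)] (φ : ∀ i, N i →+ M i)
    (hφ : ∀ i, Function.Injective (φ i)) (h : IsFamilySmall A M) : IsFamilySmall A N := by
  intro f
  obtain ⟨F, hF⟩ := h ((DFinsupp.mapRange.addMonoidHom φ).comp f)
  refine ⟨F, fun a i hi => hφ i ?_⟩
  simpa using hF a i hi

/-- Smallness relative to a family of groups `M i k` gives smallness relative to the family of
partial direct sums `⊕ k, M i k`. -/
theorem IsFamilySmall.of_sigma {A : Type*} [AddCommGroup A] {I : Type} {K : I → Type}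
    {M : ∀ i, K i → Type*} [∀ i k, AddCommGroup (M i k)]
    (h : IsFamilySmall A (fun x : Σ i, K i => M x.1 x.2)) :
    IsFamilySmall A (fun i => Π₀ k, M i k) := by
  classical
  intro f
  let e : (Π₀ i, Π₀ k, M i k) →+ Π₀ x : Σ i, K i, M x.1 x.2 :=
    { toFun := DFinsupp.sigmaUncurry
      map_zero' := DFinsupp.sigmaUncurry_zero
      map_add' := DFinsupp.sigmaUncurry_add }
  obtain ⟨F, hF⟩ := h (e.comp f)
  refine ⟨F.image Sigma.fst, fun a i hi => DFinsupp.ext fun k => ?_⟩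
  exact hF a ⟨i, k⟩ fun hk => hi (Finset.mem_image_of_mem Sigma.fst hk)

/-- Every group `B` belongs to `Add(B)`. -/
theorem MemAdd.refl (B : Type*) [AddCommGroup B] : MemAdd B B :=
  ⟨Unit, DFinsupp.singleAddHom (fun _ => B) (), DFinsupp.evalAddMonoidHom (),
    AddMonoidHom.ext fun b =>
      DFinsupp.single_eq_same (β := fun _ : Unit => B) (i := ()) (b := b)⟩

/-- For an abelian group `A` and a set `𝒞` of abelian groups with direct sum
`B = ⊕𝒞`, the following are equivalent: (1) `A` is `B`-small; (2) `A` is `𝒞`-small;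
(3) `A` is `Add(B)`-small, i.e. `A` is small relative to every family of groups each of
which is a direct summand of some `B^{(κ)}`. -/
theorem isBSmall_sum_iff_classSmall_iff_addSmall {ι : Type} (A : Type) (C : ι → Type)
    [AddCommGroup A] [∀ j, AddCommGroup (C j)] :
    List.TFAE
      [ IsBSmall A (Π₀ j, C j),
        IsClassSmall A C,
        ∀ (I : Type) (D : I → Type) [∀ i, AddCommGroup (D i)],
          (∀ i, MemAdd (Π₀ j, C j) (D i)) → IsFamilySmall A D ] := by
  classical
  tfae_have 1 → 2 := fun h I g =>
    (h I).of_injective (fun i => DFinsupp.singleAddHom C (g i)) fun _ =>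
      DFinsupp.single_injective
  tfae_have 2 → 3 := by
    intro h I D _ hD
    choose K s r hrs using hD
    refine IsFamilySmall.of_injective s (fun i => ?_) (IsFamilySmall.of_sigma
      (IsFamilySmall.of_sigma (K := fun _ => ι) (M := fun _ j => C j)
        (h (Σ _ : Σ i, K i, ι) fun x => x.2)))
    exact Function.LeftInverse.injective (g := r i) (DFunLike.congr_fun (hrs i))
  tfae_have 3 → 1 := fun h I => h I (fun _ => Π₀ j, C j) fun _ => MemAdd.refl _
  tfae_finish
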